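/- arXiv:2512.08621 — 2 statements merged into one kernel-verified Lean document; each statement's English description precedes it below -/
import Mathlib

section
/- Let H ∈ (1/2,1), c > 0 and s < t be real numbers. Let B be a finite set with |B| ≥ 4, let Δ be a partition of B and p a pairing of B such that (Δ,p) is connected. Suppose {σ} is a singleton block of Δ and {σ,ϱ} ∈ p. Set B' := B \ {σ,ϱ}, let A_ϱ be the block of Δ containing ϱ, and define Δ' := (Δ \ {{σ}, A_ϱ}) ∪ {A_ϱ \ {ϱ}} and p' := p \ {{σ,ϱ}}. Then there exists a constant C (depending on H, c, s, t, B, Δ, p but not on ε) such that for all ε ∈ (0,1]: J̃^ε(Δ,p) ≤ C · ε^{(σ(Δ)−σ(Δ'))(H−1/2) + (2−2H)} · J̃^ε(Δ',p'). -/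
open MeasureTheory Finset

variable {α : Type*} [DecidableEq α]

/-- `Δ` is a partition of the finite set `B`. -/
def IsPartitionOf (B : Finset α) (Δ : Finset (Finset α)) : Prop :=
  (∀ b ∈ Δ, b.Nonempty) ∧ Δ.sup id = B ∧
    ∀ b ∈ Δ, ∀ c ∈ Δ, b ≠ c → Disjoint b c

/-- The pair of partitions `(Δ, p)` of `B` is connected, i.e. `Δ ∨ p = {B}`. -/
def ConnectedPair (B : Finset α) (Δ p : Finset (Finset α)) : Prop :=
  ∀ S ⊆ B, (∀ b ∈ Δ, b ⊆ S ∨ Disjoint b S) → (∀ b ∈ p, b ⊆ S ∨ Disjoint b S) →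
    S = ∅ ∨ S = B

/-- Extend a function indexed by the subtype `↥B` to all of `α` by zero. -/
noncomputable def extendBy (B : Finset α) (r : {x // x ∈ B} → ℝ) (a : α) : ℝ :=
  if h : a ∈ B then r ⟨a, h⟩ else 0

/-- For a two-element set `q = {a, b}`, this is `|r a - r b|`. -/
noncomputable def pairGap (r : α → ℝ) (q : Finset α) : ℝ :=
  if h : q.Nonempty then q.sup' h r - q.inf' h r else 0

/-- The cumulant integral
`J̃^ε(Δ,p) = ε^{σ(Δ)(H−1/2)+|B|/2} ∫_{[s/ε,t/ε]^B} ∏_{A ∈ Δ, |A|≥2} e^{−c Σ_{i,j∈A}|r_i−r_j|}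
  ∏_{{a,b}∈p} |r_a−r_b|^{2H−2} dr^B`,
where `σ(Δ)` is the number of singleton blocks of `Δ`. -/
noncomputable def Jtilde (H c s t ε : ℝ) (B : Finset α) (Δ p : Finset (Finset α)) : ℝ :=
  ε ^ ((((Δ.filter fun A => A.card = 1).card : ℝ)) * (H - 1 / 2) + (B.card : ℝ) / 2) *
    ∫ r : {x // x ∈ B} → ℝ in Set.univ.pi fun _ => Set.Icc (s / ε) (t / ε),
      (∏ A ∈ Δ.filter fun A => 2 ≤ A.card,
        Real.exp (-c * ∑ i ∈ A, ∑ j ∈ A, |extendBy B r i - extendBy B r j|)) *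
      ∏ q ∈ p, pairGap (extendBy B r) q ^ (2 * H - 2)

set_option linter.unusedSectionVars false

/-- Integrating a function of the distance to `u` costs at most twice the half-line integral. -/
lemma lintegral_comp_abs_sub_le (h : ℝ → ENNReal) (u : ℝ) :
    ∫⁻ x, h |x - u| ≤ 2 * ∫⁻ x in Set.Ici 0, h x := by
  rw [lintegral_sub_right_eq_self (fun x => h |x|) u,
    ← lintegral_add_compl _ (measurableSet_Ici (a := (0 : ℝ))), two_mul]
  have hpos : ∫⁻ x in Set.Ici (0 : ℝ), h |x| = ∫⁻ x in Set.Ici 0, h x :=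
    setLIntegral_congr_fun measurableSet_Ici fun x hx => by
      simp only [abs_of_nonneg (Set.mem_Ici.1 hx)]
  have hneg := (Measure.measurePreserving_neg (volume : Measure ℝ)).setLIntegral_comp_preimage_emb
    (MeasurableEquiv.neg ℝ).measurableEmbedding (fun x => h |x|) (Set.Ici 0)
  rw [hpos] at hneg ⊢
  refine add_le_add_right ?_ _
  rw [← hneg]
  simp only [abs_neg]
  refine lintegral_mono_set fun x hx => ?_
  simp only [Set.mem_compl_iff, Set.mem_Ici, not_le] at hx
  simpa using hx.le

lemma setLIntegral_Icc_abs_rpow_le {ρ a b u : ℝ} (hρ : -1 < ρ) (hu : u ∈ Set.Icc a b) :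
    ∫⁻ v in Set.Icc a b, ENNReal.ofReal (|v - u| ^ ρ) ≤
      ENNReal.ofReal (2 * (b - a) ^ (ρ + 1) / (ρ + 1)) := by
  have hab : 0 ≤ b - a := by linarith [hu.1, hu.2]
  set h : ℝ → ENNReal := (Set.Iic (b - a)).indicator fun x => ENNReal.ofReal (x ^ ρ)
  calc
    _ = ∫⁻ v in Set.Icc a b, h |v - u| := by
      refine setLIntegral_congr_fun measurableSet_Icc fun v hv => ?_
      have : |v - u| ∈ Set.Iic (b - a) := by
        rw [Set.mem_Iic, abs_le]
        constructor <;> linarith [hu.1, hu.2, hv.1, hv.2]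
      simp only [h, Set.indicator_of_mem this]
    _ ≤ ∫⁻ v, h |v - u| := setLIntegral_le_lintegral _ _
    _ ≤ 2 * ∫⁻ x in Set.Ici 0, h x := lintegral_comp_abs_sub_le h u
    _ = 2 * ∫⁻ x in Set.Ioc 0 (b - a), ENNReal.ofReal (x ^ ρ) := by
      rw [setLIntegral_indicator measurableSet_Iic, Set.inter_comm, Set.Ici_inter_Iic,
        setLIntegral_congr Ioc_ae_eq_Icc]
    _ = 2 * ENNReal.ofReal ((b - a) ^ (ρ + 1) / (ρ + 1)) := by
      rw [← ofReal_integral_eq_lintegral_ofReal,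
        ← intervalIntegral.integral_of_le hab, integral_rpow (Or.inl hρ),
        Real.zero_rpow (by linarith), sub_zero]
      · exact (intervalIntegral.intervalIntegrable_rpow' hρ).1
      · filter_upwards [ae_restrict_mem measurableSet_Ioc] with x hx
        exact Real.rpow_nonneg hx.1.le _
    _ = _ := by
      rw [mul_div_assoc, ENNReal.ofReal_mul (by norm_num)]
      simp

lemma lintegral_exp_neg_mul_abs_le {k : ℝ} (hk : 0 < k) (u : ℝ) :
    ∫⁻ x, ENNReal.ofReal (Real.exp (-k * |x - u|)) ≤ ENNReal.ofReal (2 / k) := by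
  refine (lintegral_comp_abs_sub_le (fun x => ENNReal.ofReal (Real.exp (-k * x))) u).trans_eq ?_
  rw [setLIntegral_congr Ioi_ae_eq_Ici.symm, ← ofReal_integral_eq_lintegral_ofReal
    (integrableOn_exp_mul_Ioi (neg_neg_of_pos hk) 0) (.of_forall fun _ => (Real.exp_pos _).le),
    integral_exp_mul_Ioi (neg_neg_of_pos hk) 0, div_eq_mul_one_div 2 k,
    ENNReal.ofReal_mul (by norm_num)]
  simp

lemma pairGap_pair (r : α → ℝ) (a b : α) : pairGap r {a, b} = |r a - r b| := by
  rw [pairGap, dif_pos (insert_nonempty _ _), sup'_insert (H := singleton_nonempty b),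
    inf'_insert (H := singleton_nonempty b), sup'_singleton, inf'_singleton]
  exact max_sub_min_eq_abs' _ _

lemma pairGap_nonneg (r : α → ℝ) (q : Finset α) : 0 ≤ pairGap r q := by
  unfold pairGap
  split_ifs with h
  · obtain ⟨a, ha⟩ := h
    exact sub_nonneg.2 ((inf'_le r ha).trans (le_sup' r ha))
  · rfl

lemma pairGap_congr {r r' : α → ℝ} {q : Finset α} (h : ∀ a ∈ q, r a = r' a) :
    pairGap r q = pairGap r' q := by
  unfold pairGap
  split_ifs with hq
  · rw [sup'_congr hq rfl h, inf'_congr hq rfl h]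
  · rfl

lemma measurable_pairGap {q : Finset α} (hq : q.card = 2) :
    Measurable fun r : α → ℝ => pairGap r q := by
  obtain ⟨a, b, -, rfl⟩ := card_eq_two.1 hq
  simp only [pairGap_pair]
  fun_prop

/-- Integrating out two variables coupled by a power of their distance. -/
lemma lmarginal_insert_insert_le {ρ a b : ℝ} (hρ : -1 < ρ) {S : Finset α} {x y : α}
    (hxy : x ≠ y) (hx : x ∉ S) (hy : y ∉ S) {f g : (α → ℝ) → ENNReal} (hf : Measurable f)
    (hg : Measurable g) {e : ℝ → (α → ℝ) → ENNReal} {K : ENNReal}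
    (he : ∀ r, ∫⁻ u in Set.Icc a b, e u r ≤ K)
    (hem : ∀ r, Measurable fun u => e u r)
    (hle : ∀ r u v, f (Function.update (Function.update r y u) x v) ≤
      ENNReal.ofReal (|v - u| ^ ρ) * (e u r * g r)) :
    ∫⋯∫⁻_insert x (insert y S), f ∂(fun _ => volume.restrict (Set.Icc a b)) ≤
      (ENNReal.ofReal (2 * (b - a) ^ (ρ + 1) / (ρ + 1)) * K) •
        ∫⋯∫⁻_S, g ∂(fun _ => volume.restrict (Set.Icc a b)) := by
  set M := ENNReal.ofReal (2 * (b - a) ^ (ρ + 1) / (ρ + 1))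
  rw [lmarginal_insert' f hf (by simp [hxy, hx]), lmarginal_insert' _ _ hy]
  · have : (M * K) • ∫⋯∫⁻_S, g ∂(fun _ => volume.restrict (Set.Icc a b)) =
        ∫⋯∫⁻_S, (fun r => M * K * g r) ∂(fun _ => volume.restrict (Set.Icc a b)) := by
      ext r
      simp only [lmarginal, Pi.smul_apply, smul_eq_mul]
      exact (lintegral_const_mul _ (hg.comp measurable_updateFinset)).symm
    rw [this]
    refine lmarginal_mono fun r => ?_
    calc
      _ ≤ ∫⁻ u in Set.Icc a b, M * (e u r * g r) := by
        refine setLIntegral_mono (((hem r).mul_const _).const_mul _) fun u hu => ?_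
        refine (lintegral_mono fun v => hle r u v).trans ?_
        rw [lintegral_mul_const _ (by fun_prop)]
        gcongr
        exact setLIntegral_Icc_abs_rpow_le hρ hu
      _ = M * ((∫⁻ u in Set.Icc a b, e u r) * g r) := by
        rw [lintegral_const_mul _ ((hem r).mul_const _), lintegral_mul_const _ (hem r)]
      _ ≤ M * K * g r := by
        rw [mul_assoc]
        gcongr
        exact he r
  · exact Measurable.lintegral_prod_right'
        (f := fun z : (α → ℝ) × ℝ => f (Function.update z.1 x z.2))
      (hf.comp measurable_update')

/-- The exponential weight of a block. -/
noncomputable def blockWeight (c : ℝ) (r : α → ℝ) (A : Finset α) : ℝ :=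
  Real.exp (-c * ∑ i ∈ A, ∑ j ∈ A, |r i - r j|)

/-- The integrand of the cumulant integral, with exponent `ρ` on the pair gaps. -/
noncomputable def cumulantWeight (c ρ : ℝ) (Δ p : Finset (Finset α)) (r : α → ℝ) : ℝ :=
  (∏ A ∈ Δ, blockWeight c r A) * ∏ q ∈ p, pairGap r q ^ ρ

lemma blockWeight_pos (c : ℝ) (r : α → ℝ) (A : Finset α) : 0 < blockWeight c r A :=
  Real.exp_pos _

lemma blockWeight_le_one {c : ℝ} (hc : 0 ≤ c) (r : α → ℝ) (A : Finset α) :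
    blockWeight c r A ≤ 1 := by
  refine Real.exp_le_one_iff.2 ?_
  rw [neg_mul, neg_nonpos]
  positivity

lemma blockWeight_eq_one_of_card_le_one (c : ℝ) (r : α → ℝ) {A : Finset α} (hA : A.card ≤ 1) :
    blockWeight c r A = 1 := by
  have : ∑ i ∈ A, ∑ j ∈ A, |r i - r j| = 0 :=
    sum_eq_zero fun i hi => sum_eq_zero fun j hj => by
      rw [card_le_one.1 hA i hi j hj, sub_self, abs_zero]
  rw [blockWeight, this, mul_zero, Real.exp_zero]

lemma blockWeight_congr (c : ℝ) {r r' : α → ℝ} {A : Finset α} (h : ∀ a ∈ A, r a = r' a) :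
    blockWeight c r A = blockWeight c r' A := by
  unfold blockWeight
  rw [sum_congr rfl fun i hi => sum_congr rfl fun j hj => by rw [h i hi, h j hj]]

lemma blockWeight_le_erase {c : ℝ} (hc : 0 ≤ c) (r : α → ℝ) {A : Finset α} {x y : α}
    (hx : x ∈ A) (hy : y ∈ A.erase x) :
    blockWeight c r A ≤ Real.exp (-(2 * c) * |r x - r y|) * blockWeight c r (A.erase x) := by
  unfold blockWeight
  rw [← Real.exp_add, Real.exp_le_exp]
  have hsum : ∑ i ∈ A, ∑ j ∈ A, |r i - r j| =
      2 * ∑ j ∈ A.erase x, |r x - r j| + ∑ i ∈ A.erase x, ∑ j ∈ A.erase x, |r i - r j| := by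
    have hx' : x ∉ A.erase x := notMem_erase x A
    conv_lhs => rw [← insert_erase hx]
    simp only [sum_insert hx', sub_self, abs_zero, zero_add, sum_add_distrib]
    rw [sum_congr rfl fun i _ => abs_sub_comm (r i) (r x)]
    ring
  have hle : |r x - r y| ≤ ∑ j ∈ A.erase x, |r x - r j| :=
    single_le_sum (f := fun j => |r x - r j|) (fun j _ => abs_nonneg _) hy
  rw [hsum]
  nlinarith [mul_le_mul_of_nonneg_left hle hc]

lemma measurable_blockWeight (c : ℝ) (A : Finset α) :
    Measurable fun r : α → ℝ => blockWeight c r A := by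
  unfold blockWeight
  fun_prop

lemma measurable_cumulantWeight (c ρ : ℝ) (Δ : Finset (Finset α)) {p : Finset (Finset α)}
    (hpair : ∀ q ∈ p, q.card = 2) : Measurable (cumulantWeight c ρ Δ p) :=
  (Finset.measurable_fun_prod _ fun A _ => measurable_blockWeight c A).mul
    (Finset.measurable_fun_prod _ fun q hq => (measurable_pairGap (hpair q hq)).pow_const ρ)

lemma cumulantWeight_nonneg (c ρ : ℝ) (Δ p : Finset (Finset α)) (r : α → ℝ) :
    0 ≤ cumulantWeight c ρ Δ p r :=
  mul_nonneg (prod_nonneg fun A _ => (blockWeight_pos c r A).le)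
    (prod_nonneg fun q _ => Real.rpow_nonneg (pairGap_nonneg r q) _)

lemma cumulantWeight_le_prod {c : ℝ} (hc : 0 ≤ c) (ρ : ℝ) (Δ p : Finset (Finset α)) (r : α → ℝ) :
    cumulantWeight c ρ Δ p r ≤ ∏ q ∈ p, pairGap r q ^ ρ :=
  mul_le_of_le_one_left (prod_nonneg fun q _ => Real.rpow_nonneg (pairGap_nonneg r q) _)
    (prod_le_one (fun A _ => (blockWeight_pos c r A).le) fun A _ => blockWeight_le_one hc r A)

lemma Jtilde_eq_lmarginal (H c s t ε : ℝ) (B : Finset α) (Δ : Finset (Finset α))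
    {p : Finset (Finset α)} (hpair : ∀ q ∈ p, q.card = 2) :
    Jtilde H c s t ε B Δ p =
      ε ^ ((((Δ.filter fun A => A.card = 1).card : ℝ)) * (H - 1 / 2) + (B.card : ℝ) / 2) *
        ((∫⋯∫⁻_B, (fun r => ENNReal.ofReal (cumulantWeight c (2 * H - 2) Δ p r))
          ∂(fun _ => volume.restrict (Set.Icc (s / ε) (t / ε)))) 0).toReal := by
  have hext (r : {x // x ∈ B} → ℝ) : extendBy B r = Function.updateFinset (0 : α → ℝ) B r := rfl
  have hprod (r : α → ℝ) : ∏ A ∈ Δ.filter fun A => 2 ≤ A.card, blockWeight c r A =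
      ∏ A ∈ Δ, blockWeight c r A :=
    prod_filter_of_ne fun A _ h => by
      by_contra hA
      exact h (blockWeight_eq_one_of_card_le_one c r (by omega))
  have hint (r : {x // x ∈ B} → ℝ) : (∏ A ∈ Δ.filter fun A => 2 ≤ A.card,
        Real.exp (-c * ∑ i ∈ A, ∑ j ∈ A, |extendBy B r i - extendBy B r j|)) *
      ∏ q ∈ p, pairGap (extendBy B r) q ^ (2 * H - 2) =
      cumulantWeight c (2 * H - 2) Δ p (Function.updateFinset (0 : α → ℝ) B r) := by
    rw [cumulantWeight, ← hprod, ← hext]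
    rfl
  unfold Jtilde
  simp only [hint]
  rw [integral_eq_lintegral_of_nonneg_ae (.of_forall fun _ => cumulantWeight_nonneg _ _ _ _ _)
    ((measurable_cumulantWeight c _ Δ hpair).comp measurable_updateFinset).aestronglyMeasurable,
    volume_pi, Measure.restrict_pi_pi]
  rfl

lemma IsPartitionOf.of_insert {B q : Finset α} {p : Finset (Finset α)}
    (h : IsPartitionOf B (insert q p)) (hq : q ∉ p) :
    IsPartitionOf (p.sup id) p ∧ Disjoint q (p.sup id) ∧ B = q ∪ p.sup id := by
  obtain ⟨hne, hsup, hdisj⟩ := h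
  refine ⟨⟨fun b hb => hne b (mem_insert_of_mem hb), rfl, fun b hb d hd =>
    hdisj b (mem_insert_of_mem hb) d (mem_insert_of_mem hd)⟩, ?_, ?_⟩
  · rw [Finset.disjoint_sup_right]
    exact fun b hb => hdisj q (mem_insert_self q p) b (mem_insert_of_mem hb) (by
      rintro rfl; exact hq hb)
  · rw [← hsup, sup_insert]
    rfl

lemma IsPartitionOf.erase {B q : Finset α} {p : Finset (Finset α)}
    (h : IsPartitionOf B p) (hq : q ∈ p) :
    IsPartitionOf (B \ q) (p.erase q) ∧ q ⊆ B := by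
  rw [← insert_erase hq] at h
  obtain ⟨h1, h2, rfl⟩ := h.of_insert (notMem_erase q p)
  rw [union_sdiff_cancel_left h2]
  exact ⟨h1, subset_union_left⟩

lemma prod_pairGap_update_update {p : Finset (Finset α)} {x y : α} (ρ : ℝ)
    (hx : ∀ q ∈ p, x ∉ q) (hy : ∀ q ∈ p, y ∉ q) (r : α → ℝ) (u v : ℝ) :
    ∏ q ∈ p, pairGap (Function.update (Function.update r y u) x v) q ^ ρ =
      ∏ q ∈ p, pairGap r q ^ ρ :=
  prod_congr rfl fun q hq => by
    rw [pairGap_congr fun a ha => ?_]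
    rw [Function.update_of_ne (ne_of_mem_of_not_mem ha (hx q hq)),
      Function.update_of_ne (ne_of_mem_of_not_mem ha (hy q hq))]

/-- The product of the singular pair factors is integrable over every cube. -/
lemma lmarginal_prod_pairGap_lt_top {ρ a b : ℝ} (hρ : -1 < ρ) {p : Finset (Finset α)}
    {B : Finset α} (hp : IsPartitionOf B p) (hpair : ∀ q ∈ p, q.card = 2) (r : α → ℝ) :
    (∫⋯∫⁻_B, (fun r => ENNReal.ofReal (∏ q ∈ p, pairGap r q ^ ρ))
      ∂(fun _ => volume.restrict (Set.Icc a b))) r < ⊤ := by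
  induction p using Finset.induction generalizing B with
  | empty =>
    obtain rfl : B = ∅ := hp.2.1.symm
    simp
  | insert q p hq ih =>
    obtain ⟨hp', hdisj, rfl⟩ := hp.of_insert hq
    have hpair' : ∀ q ∈ p, q.card = 2 := fun q hq => hpair q (mem_insert_of_mem hq)
    have hmeas {p : Finset (Finset α)} (hpair : ∀ q ∈ p, q.card = 2) :
        Measurable fun r : α → ℝ => ENNReal.ofReal (∏ q ∈ p, pairGap r q ^ ρ) :=
      (Finset.measurable_fun_prod _ fun q hq =>
        (measurable_pairGap (hpair q hq)).pow_const ρ).ennreal_ofReal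
    obtain ⟨x, y, hxy, rfl⟩ := card_eq_two.1 (hpair q (mem_insert_self q p))
    rw [disjoint_insert_left, disjoint_singleton_left] at hdisj
    have hnot {z : α} (hz : z ∉ p.sup id) : ∀ q ∈ p, z ∉ q := fun q hq hzq =>
      hz (mem_of_subset (le_sup (f := id) hq) hzq)
    have key := lmarginal_insert_insert_le (a := a) (b := b) hρ hxy hdisj.1 hdisj.2 (hmeas hpair)
      (hmeas hpair') (e := fun _ _ => 1) (K := ENNReal.ofReal (b - a)) (by simp)
      (fun _ => measurable_const) (fun r u v => by
        rw [prod_insert hq, prod_pairGap_update_update ρ (hnot hdisj.1) (hnot hdisj.2),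
          pairGap_pair, one_mul, ENNReal.ofReal_mul (by positivity)]
        simp [Function.update_of_ne hxy.symm]) r
    rw [insert_union, singleton_union]
    refine key.trans_lt ?_
    simp only [Pi.smul_apply, smul_eq_mul]
    exact ENNReal.mul_lt_top (ENNReal.mul_lt_top ENNReal.ofReal_lt_top ENNReal.ofReal_lt_top)
      (ih hp' hpair')

lemma IsPartitionOf.notMem_of_mem {B A A' : Finset α} {Δ : Finset (Finset α)}
    (h : IsPartitionOf B Δ) (hA : A ∈ Δ) (hA' : A' ∈ Δ) (hne : A ≠ A') {x : α} (hx : x ∈ A) :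
    x ∉ A' :=
  disjoint_left.1 (h.2.2 A hA A' hA' hne) hx

/-- In a connected pair on more than two points, the partner of a singleton lies in a larger
block. -/
lemma ConnectedPair.erase_nonempty {B A : Finset α} {Δ p : Finset (Finset α)}
    (hconn : ConnectedPair B Δ p) (hΔ : IsPartitionOf B Δ) (hp : IsPartitionOf B p)
    (hB : 2 < B.card) {x y : α} (hx : {x} ∈ Δ) (hxy : {x, y} ∈ p) (hA : A ∈ Δ) (hy : y ∈ A) :
    (A.erase y).Nonempty := by
  rw [nonempty_iff_ne_empty]
  intro hempty
  obtain rfl : A = {y} := by rw [← insert_erase hy, hempty]; rfl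
  have key : ({x, y} : Finset α) = ∅ ∨ {x, y} = B := by
    refine hconn {x, y} (hp.erase hxy).2 (fun b hb => ?_) (fun b hb => ?_)
    · by_cases h1 : b = {x}
      · exact .inl (by simp [h1])
      by_cases h2 : b = {y}
      · exact .inl (by simp [h2])
      right
      rw [disjoint_insert_right, disjoint_singleton_right]
      exact ⟨hΔ.notMem_of_mem hx hb (Ne.symm h1) (mem_singleton_self x),
        hΔ.notMem_of_mem hA hb (Ne.symm h2) (mem_singleton_self y)⟩
    · by_cases h1 : b = {x, y}
      · exact .inl h1.subset
      · exact .inr (hp.2.2 b hb _ hxy h1)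
  rcases key with h | h
  · exact insert_ne_empty _ _ h
  · rw [← h] at hB
    exact hB.not_ge card_le_two

/-- Pointwise comparison of the integrand with the one obtained by removing the pair `{σ, ϱ}`. -/
lemma cumulantWeight_update_update_le {c : ℝ} (hc : 0 ≤ c) (ρ : ℝ) {B A : Finset α}
    {Δ p : Finset (Finset α)} (hΔ : IsPartitionOf B Δ) (hp : IsPartitionOf B p) {x y z : α}
    (hx : {x} ∈ Δ) (hxy : {x, y} ∈ p) (hne : x ≠ y) (hA : A ∈ Δ) (hy : y ∈ A)
    (hz : z ∈ A.erase y) (r : α → ℝ) (u v : ℝ) :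
    cumulantWeight c ρ Δ p (Function.update (Function.update r y u) x v) ≤
      |v - u| ^ ρ * (Real.exp (-(2 * c) * |u - r z|) *
        cumulantWeight c ρ ((Δ \ {{x}, A}) ∪ {A.erase y}) (p \ {{x, y}}) r) := by
  set r' := Function.update (Function.update r y u) x v with hr'
  have hr'x : r' x = v := Function.update_self _ _ _
  have hr'y : r' y = u := by
    rw [hr', Function.update_of_ne hne.symm, Function.update_self]
  have hr'of {a : α} (hax : a ≠ x) (hay : a ≠ y) : r' a = r a := by
    rw [hr', Function.update_of_ne hax, Function.update_of_ne hay]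
  have hAx : A ≠ {x} := by
    rintro rfl
    exact hne (mem_singleton.1 hy).symm
  have hxA : x ∉ A := hΔ.notMem_of_mem hx hA hAx.symm (mem_singleton_self x)
  have hzA : z ∈ A := mem_of_mem_erase hz
  set Δ₀ := Δ \ {{x}, A} with hΔ₀
  have hmem {b : Finset α} (hb : b ∈ Δ₀) : b ∈ Δ ∧ b ≠ {x} ∧ b ≠ A := by
    simpa [hΔ₀] using hb
  have hAΔ₀ : A.erase y ∉ Δ₀ := fun h =>
    hΔ.notMem_of_mem hA (hmem h).1 (hmem h).2.2.symm hzA hz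
  have hΔeq : Δ = insert {x} (insert A Δ₀) := by
    ext b
    simp only [hΔ₀, mem_insert, mem_sdiff, mem_singleton]
    by_cases h1 : b = {x}
    · simp [h1, hx]
    · by_cases h2 : b = A
      · simp [h2, hA]
      · simp [h1, h2]
  have hΔprod : ∏ b ∈ Δ, blockWeight c r' b =
      blockWeight c r' A * ∏ b ∈ Δ₀, blockWeight c r b := by
    rw [hΔeq, prod_insert (by simp [hΔ₀, hAx.symm]), prod_insert (by simp [hΔ₀]),
      blockWeight_eq_one_of_card_le_one c r' (by simp), one_mul]
    congr 1
    refine prod_congr rfl fun b hb => blockWeight_congr c fun a ha => hr'of ?_ ?_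
    · rintro rfl
      exact hΔ.notMem_of_mem hx (hmem hb).1 (hmem hb).2.1.symm (mem_singleton_self a) ha
    · rintro rfl
      exact hΔ.notMem_of_mem hA (hmem hb).1 (hmem hb).2.2.symm hy ha
  have hAle : blockWeight c r' A ≤
      Real.exp (-(2 * c) * |u - r z|) * blockWeight c r (A.erase y) := by
    have hr'A {a : α} (ha : a ∈ A.erase y) : r' a = r a :=
      hr'of (ne_of_mem_of_not_mem (mem_of_mem_erase ha) hxA) (ne_of_mem_erase ha)
    have := blockWeight_le_erase hc r' hy hz
    rwa [hr'y, hr'A hz, blockWeight_congr c fun a ha => hr'A ha] at this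
  have hpprod : ∏ q ∈ p, pairGap r' q ^ ρ =
      |v - u| ^ ρ * ∏ q ∈ p.erase {x, y}, pairGap r q ^ ρ := by
    have hnot {w : α} (hw : w ∈ ({x, y} : Finset α)) : ∀ q ∈ p.erase {x, y}, w ∉ q :=
      fun q hq => hp.notMem_of_mem hxy (mem_of_mem_erase hq) (ne_of_mem_erase hq).symm hw
    rw [← mul_prod_erase p _ hxy, pairGap_pair, hr'x, hr'y,
      prod_pairGap_update_update ρ (hnot (by simp)) (hnot (by simp))]
  have h1 : 0 ≤ ∏ b ∈ Δ₀, blockWeight c r b := prod_nonneg fun b _ => (blockWeight_pos c r b).le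
  have h2 : 0 ≤ ∏ q ∈ p.erase {x, y}, pairGap r q ^ ρ :=
    prod_nonneg fun q _ => Real.rpow_nonneg (pairGap_nonneg r q) _
  rw [cumulantWeight, cumulantWeight, hΔprod, hpprod, union_comm, ← insert_eq,
    prod_insert hAΔ₀, sdiff_singleton_eq_erase]
  calc
    _ ≤ (Real.exp (-(2 * c) * |u - r z|) * blockWeight c r (A.erase y)) *
        (∏ b ∈ Δ₀, blockWeight c r b) *
        (|v - u| ^ ρ * ∏ q ∈ p.erase {x, y}, pairGap r q ^ ρ) := by gcongr
    _ = _ := by ring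

theorem stmt2 (H c s t : ℝ) (hH : H ∈ Set.Ioo (1 / 2 : ℝ) 1) (hc : 0 < c) (hst : s < t)
    (B : Finset α) (hB : 4 ≤ B.card)
    (Δ p : Finset (Finset α))
    (hΔ : IsPartitionOf B Δ) (hp : IsPartitionOf B p)
    (hpair : ∀ b ∈ p, b.card = 2) (hconn : ConnectedPair B Δ p)
    (σ ϱ : α) (hσ : ({σ} : Finset α) ∈ Δ) (hσϱ : ({σ, ϱ} : Finset α) ∈ p) (hne : σ ≠ ϱ)
    (Aϱ : Finset α) (hAϱ : Aϱ ∈ Δ) (hϱA : ϱ ∈ Aϱ) :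
    ∃ C : ℝ, ∀ ε ∈ Set.Ioc (0 : ℝ) 1,
      Jtilde H c s t ε B Δ p ≤
        C * ε ^ (((((Δ.filter fun A => A.card = 1).card : ℝ) -
              ((((Δ \ {({σ} : Finset α), Aϱ}) ∪ {Aϱ.erase ϱ}).filter
                  fun A => A.card = 1).card : ℝ)) * (H - 1 / 2)) + (2 - 2 * H)) *
          Jtilde H c s t ε (B \ {σ, ϱ})
            ((Δ \ {({σ} : Finset α), Aϱ}) ∪ {Aϱ.erase ϱ})
            (p \ {({σ, ϱ} : Finset α)}) := by
  obtain ⟨hH₁, hH₂⟩ := hH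
  obtain ⟨z, hz⟩ := hconn.erase_nonempty hΔ hp (by omega) hσ hσϱ hAϱ hϱA
  obtain ⟨hp', hsub⟩ := hp.erase hσϱ
  rw [← sdiff_singleton_eq_erase] at hp'
  have hpair' : ∀ q ∈ p \ {{σ, ϱ}}, q.card = 2 := fun q hq => hpair q (mem_sdiff.1 hq).1
  have hρ : -1 < 2 * H - 2 := by linarith
  have hρ1 : 0 < 2 * H - 2 + 1 := by linarith
  have hBeq : B = insert σ (insert ϱ (B \ {σ, ϱ})) := by
    rw [← singleton_union ϱ, ← insert_union, union_sdiff_of_subset hsub]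
  have hcard : (B.card : ℝ) = ((B \ {σ, ϱ}).card : ℝ) + 2 := by
    have := card_sdiff_add_card_eq_card hsub
    rw [card_pair hne] at this
    exact_mod_cast this.symm
  refine ⟨2 * (t - s) ^ (2 * H - 2 + 1) / (2 * H - 2 + 1) * (2 / (2 * c)), fun ε hε => ?_⟩
  have hε0 : 0 < ε := hε.1
  rw [Jtilde_eq_lmarginal _ _ _ _ _ _ _ hpair, Jtilde_eq_lmarginal _ _ _ _ _ _ _ hpair']
  set Δ' := (Δ \ {{σ}, Aϱ}) ∪ {Aϱ.erase ϱ}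
  set L := (∫⋯∫⁻_B, (fun r => ENNReal.ofReal (cumulantWeight c (2 * H - 2) Δ p r))
    ∂(fun _ => volume.restrict (Set.Icc (s / ε) (t / ε)))) 0
  set R := (∫⋯∫⁻_B \ {σ, ϱ},
    (fun r => ENNReal.ofReal (cumulantWeight c (2 * H - 2) Δ' (p \ {{σ, ϱ}}) r))
    ∂(fun _ => volume.restrict (Set.Icc (s / ε) (t / ε)))) 0
  have hRfin : R < ⊤ :=
    (lmarginal_mono (fun r => ENNReal.ofReal_le_ofReal
      (cumulantWeight_le_prod hc.le _ _ _ r)) _).trans_lt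
      (lmarginal_prod_pairGap_lt_top hρ hp' hpair' 0)
  have hLR : L ≤ ENNReal.ofReal (2 * (t / ε - s / ε) ^ (2 * H - 2 + 1) / (2 * H - 2 + 1)) *
      ENNReal.ofReal (2 / (2 * c)) * R := by
    have key := lmarginal_insert_insert_le (a := s / ε) (b := t / ε) (S := B \ {σ, ϱ}) hρ hne
      (by simp) (by simp) (measurable_cumulantWeight c (2 * H - 2) Δ hpair).ennreal_ofReal
      (measurable_cumulantWeight c (2 * H - 2) Δ' hpair').ennreal_ofReal
      (e := fun u r => ENNReal.ofReal (Real.exp (-(2 * c) * |u - r z|)))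
      (fun r => (setLIntegral_le_lintegral _ _).trans
        (lintegral_exp_neg_mul_abs_le (by positivity) (r z)))
      (fun r => by fun_prop) (fun r u v => by
        rw [← ENNReal.ofReal_mul (by positivity), ← ENNReal.ofReal_mul (by positivity)]
        exact ENNReal.ofReal_le_ofReal (cumulantWeight_update_update_le hc.le _ hΔ hp hσ hσϱ hne
          hAϱ hϱA hz r u v)) 0
    rwa [← hBeq] at key
  have hts : 0 < t - s := sub_pos.2 hst
  have hscale : (t / ε - s / ε) ^ (2 * H - 2 + 1) =
      (t - s) ^ (2 * H - 2 + 1) * ε ^ (-(2 * H - 2 + 1)) := by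
    rw [← sub_div, Real.div_rpow hts.le hε0.le, Real.rpow_neg hε0.le, div_eq_mul_inv]
  have hLR' := ENNReal.toReal_mono
    (ENNReal.mul_ne_top (ENNReal.mul_ne_top ENNReal.ofReal_ne_top ENNReal.ofReal_ne_top)
      hRfin.ne) hLR
  rw [ENNReal.toReal_mul, ENNReal.toReal_mul, hscale, ENNReal.toReal_ofReal (by positivity),
    ENNReal.toReal_ofReal (by positivity)] at hLR'
  refine (mul_le_mul_of_nonneg_left hLR' (by positivity)).trans_eq ?_
  set N := ((Δ.filter fun A => A.card = 1).card : ℝ)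
  set N' := ((Δ'.filter fun A => A.card = 1).card : ℝ)
  have hpow : ε ^ (N * (H - 1 / 2) + (B.card : ℝ) / 2) * ε ^ (-(2 * H - 2 + 1)) =
      ε ^ ((N - N') * (H - 1 / 2) + (2 - 2 * H)) *
        ε ^ (N' * (H - 1 / 2) + ((B \ {σ, ϱ}).card : ℝ) / 2) := by
    rw [← Real.rpow_add hε0, ← Real.rpow_add hε0, hcard]
    ring_nf
  linear_combination (2 * (t - s) ^ (2 * H - 2 + 1) / (2 * H - 2 + 1) * (2 / (2 * c)) *
    R.toReal) * hpow
end

section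
/- Let H ∈ (1/2,1), c > 0, let N ≥ 2 be an integer and let s < t be real numbers. There exists a constant C, depending on H, c, N, s, t but not on ε, such that for all ε ∈ (0,1]: ε^N ∫_{[s/ε, t/ε]^{2N}} ∏_{i=1}^N e^{-c|u_i − v_i|} |v_i − u_{i+1}|^{2H−2} du_1 ⋯ du_N dv_1 ⋯ dv_N ≤ C ε^{2−2H}, with the cyclic convention u_{N+1} := u_1. -/
open MeasureTheory

open scoped ENNReal

theorem lintegral_fin_nat_prod_eq_prod {α : Type*} [MeasurableSpace α] (μ : Measure α)
    [SigmaFinite μ] {n : ℕ} (f : Fin n → α → ℝ≥0∞) (hf : ∀ i, Measurable (f i)) :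
    ∫⁻ x, ∏ i, f i (x i) ∂(Measure.pi fun _ : Fin n => μ) = ∏ i, ∫⁻ x, f i x ∂μ := by
  induction n with
  | zero => simp
  | succ n ih =>
    have hmp := (measurePreserving_piFinSuccAbove (fun _ : Fin (n + 1) => μ) 0).symm
    rw [← hmp.lintegral_comp_emb (MeasurableEquiv.measurableEmbedding _),
      lintegral_prod _ (by
        refine Measurable.aemeasurable (Measurable.comp (g := fun x : Fin (n + 1) → α =>
          ∏ i, f i (x i)) ?_ (MeasurableEquiv.measurable _))
        exact Finset.measurable_prod _ fun i _ => (hf i).comp (measurable_pi_apply i))]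
    simp only [Fin.prod_univ_succ, MeasurableEquiv.piFinSuccAbove_symm_apply,
      Fin.insertNthEquiv_zero, Fin.consEquiv_apply, Fin.cons_zero, Fin.cons_succ]
    rw [← ih (fun i => f i.succ) fun i => hf i.succ, ← lintegral_mul_const _ (hf 0)]
    refine lintegral_congr fun x => ?_
    rw [lintegral_const_mul]
    exact Finset.measurable_prod _ fun i _ => (hf _).comp (measurable_pi_apply i)

/-- A cyclic product of bounded kernels, one of which has bounded integrals in its first variable,
has an integral controlled by these bounds and the total mass. -/
theorem lintegral_prod_cyclic_le {α : Type*} [MeasurableSpace α] (μ : Measure α) [SigmaFinite μ]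
    (n : ℕ) (k : α → α → ℝ≥0∞) (hk : Measurable (Function.uncurry k)) (A M : ℝ≥0∞)
    (hM : ∀ x y, k x y ≤ M) (hA : ∀ᵐ y ∂μ, ∫⁻ x, k x y ∂μ ≤ A) :
    ∫⁻ u, ∏ i, k (u i) (u (i + 1)) ∂(Measure.pi fun _ : Fin (n + 2) => μ) ≤
      A * M ^ (n + 1) * μ Set.univ ^ (n + 1) := by
  have hmp := (measurePreserving_piFinSuccAbove (fun _ : Fin (n + 2) => μ) 0).symm
  have hk0 : Measurable fun q : α × (Fin (n + 1) → α) => k q.1 (q.2 0) :=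
    hk.comp (measurable_fst.prodMk ((measurable_pi_apply 0).comp measurable_snd))
  calc ∫⁻ u, ∏ i, k (u i) (u (i + 1)) ∂(Measure.pi fun _ : Fin (n + 2) => μ)
      ≤ ∫⁻ u, k (u 0) (u 1) * M ^ (n + 1) ∂(Measure.pi fun _ : Fin (n + 2) => μ) := by
        refine lintegral_mono fun u => ?_
        rw [Fin.prod_univ_succ, zero_add]
        refine mul_le_mul_right ((Finset.prod_le_prod' fun i _ => hM _ _).trans ?_) _
        simp
    _ = ∫⁻ q, k q.1 (q.2 0) * M ^ (n + 1)
          ∂(μ.prod (Measure.pi fun _ : Fin (n + 1) => μ)) := by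
        rw [← hmp.lintegral_comp_emb (MeasurableEquiv.measurableEmbedding _)]
        rfl
    _ = ∫⁻ w, (∫⁻ x, k x (w 0) ∂μ) * M ^ (n + 1) ∂(Measure.pi fun _ : Fin (n + 1) => μ) := by
        rw [lintegral_prod_symm _ (hk0.mul_const _).aemeasurable]
        refine lintegral_congr fun w => ?_
        rw [lintegral_mul_const]
        exact hk.comp (measurable_id.prodMk measurable_const)
    _ ≤ ∫⁻ _, A * M ^ (n + 1) ∂(Measure.pi fun _ : Fin (n + 1) => μ) := by
        refine lintegral_mono_ae ?_
        filter_upwards [(Measure.quasiMeasurePreserving_eval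
          (fun _ : Fin (n + 1) => μ) 0).ae hA] with w hw
        gcongr
    _ = A * M ^ (n + 1) * μ Set.univ ^ (n + 1) := by
        rw [lintegral_const, Measure.pi_univ]
        simp

theorem lintegral_abs_rpow_Icc_le {a : ℝ} (ha : -1 < a) {L : ℝ} (hL : 0 ≤ L) :
    ∫⁻ x in Set.Icc (-L) L, ENNReal.ofReal (|x| ^ a) ≤
      ENNReal.ofReal (2 / (a + 1) * L ^ (a + 1)) := by
  have hpos : ∫⁻ x in Set.Icc 0 L, ENNReal.ofReal (|x| ^ a) =
      ENNReal.ofReal (L ^ (a + 1) / (a + 1)) := by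
    have hint := (intervalIntegral.intervalIntegrable_rpow' (a := 0) (b := L) ha)
    rw [intervalIntegrable_iff_integrableOn_Icc_of_le hL] at hint
    rw [setLIntegral_congr_fun measurableSet_Icc
      (fun x hx => by rw [abs_of_nonneg hx.1] :
        Set.EqOn _ (fun x : ℝ => ENNReal.ofReal (x ^ a)) _),
      ← ofReal_integral_eq_lintegral_ofReal hint, integral_Icc_eq_integral_Ioc,
      ← intervalIntegral.integral_of_le hL, integral_rpow (Or.inl ha),
      Real.zero_rpow (by linarith), sub_zero]
    filter_upwards [ae_restrict_mem measurableSet_Icc] with x hx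
    exact Real.rpow_nonneg hx.1 _
  have hneg : ∫⁻ x in Set.Icc (-L) 0, ENNReal.ofReal (|x| ^ a) =
      ∫⁻ x in Set.Icc 0 L, ENNReal.ofReal (|x| ^ a) := by
    rw [← (Measure.measurePreserving_neg (volume : Measure ℝ)).setLIntegral_comp_preimage_emb
      (MeasurableEquiv.neg ℝ).measurableEmbedding _ (Set.Icc 0 L)]
    simp
  calc ∫⁻ x in Set.Icc (-L) L, ENNReal.ofReal (|x| ^ a)
      ≤ ∫⁻ x in Set.Icc (-L) 0 ∪ Set.Icc 0 L, ENNReal.ofReal (|x| ^ a) :=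
        lintegral_mono_set fun x hx => (le_total x 0).imp (fun h => ⟨hx.1, h⟩) fun h => ⟨h, hx.2⟩
    _ ≤ _ := lintegral_union_le _ _ _
    _ = ENNReal.ofReal (2 / (a + 1) * L ^ (a + 1)) := by
        have : 0 ≤ L ^ (a + 1) / (a + 1) := div_nonneg (Real.rpow_nonneg hL _) (by linarith)
        rw [hneg, hpos, ← ENNReal.ofReal_add this this]
        congr 1
        ring

theorem lintegral_exp_neg_mul_abs_lt_top {c : ℝ} (hc : 0 < c) :
    ∫⁻ x : ℝ, ENNReal.ofReal (Real.exp (-c * |x|)) < ∞ := by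
  have h : Integrable fun x : ℝ => Real.exp (-c * |x|) := by
    refine .of_integral_ne_zero ?_
    rw [integral_comp_abs (f := fun x => Real.exp (-c * x)),
      integral_exp_mul_Ioi (neg_lt_zero.2 hc)]
    simp [hc.ne']
  exact h.lintegral_lt_top

/-- The convolution of `exp (-c |x|)` and `|x| ^ a` over the interval `[p, q]`. -/
noncomputable def expRpowKernel (c a p q x y : ℝ) : ℝ≥0∞ :=
  ∫⁻ v in Set.Icc p q,
    ENNReal.ofReal (Real.exp (-c * |x - v|)) * ENNReal.ofReal (|v - y| ^ a)

theorem measurable_expRpowKernel (c a p q : ℝ) :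
    Measurable (Function.uncurry (expRpowKernel c a p q)) := by
  unfold expRpowKernel Function.uncurry
  refine Measurable.lintegral_prod_right (f := fun (z : ℝ × ℝ) (v : ℝ) =>
    ENNReal.ofReal (Real.exp (-c * |z.1 - v|)) * ENNReal.ofReal (|v - z.2| ^ a)) ?_
  simp only [← Real.norm_eq_abs]
  unfold Function.uncurry
  fun_prop

theorem expRpowKernel_le {c a : ℝ} (hc : 0 < c) (ha : a ≤ 0) (p q x y : ℝ) :
    expRpowKernel c a p q x y ≤
      (∫⁻ v in Set.Icc (-1 : ℝ) 1, ENNReal.ofReal (|v| ^ a)) +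
        ∫⁻ v : ℝ, ENNReal.ofReal (Real.exp (-c * |v|)) := by
  rw [← lintegral_indicator measurableSet_Icc,
    ← lintegral_sub_right_eq_self (μ := volume) (Set.indicator _ _) y,
    ← lintegral_sub_left_eq_self (fun v : ℝ => ENNReal.ofReal (Real.exp (-c * |v|))) x,
    ← lintegral_add_right]
  · refine (setLIntegral_le_lintegral _ _).trans (lintegral_mono fun v => ?_)
    by_cases hv : |v - y| ≤ 1
    · rw [Set.indicator_of_mem (Set.mem_Icc.2 (abs_le.1 hv))]
      refine le_add_right (mul_le_of_le_one_left zero_le ?_)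
      rw [ENNReal.ofReal_le_one, Real.exp_le_one_iff]
      nlinarith [abs_nonneg (x - v)]
    · refine le_add_left (mul_le_of_le_one_right zero_le ?_)
      rw [ENNReal.ofReal_le_one]
      exact Real.rpow_le_one_of_one_le_of_nonpos (not_le.1 hv).le ha
  · simp only [← Real.norm_eq_abs]
    fun_prop

theorem setLIntegral_expRpowKernel_le {c a p q : ℝ} {y : ℝ}
    (hy : y ∈ Set.Icc p q) :
    ∫⁻ x in Set.Icc p q, expRpowKernel c a p q x y ≤
      (∫⁻ v : ℝ, ENNReal.ofReal (Real.exp (-c * |v|))) *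
        ∫⁻ v in Set.Icc (-(q - p)) (q - p), ENNReal.ofReal (|v| ^ a) := by
  unfold expRpowKernel
  rw [lintegral_lintegral_swap (by
    simp only [← Real.norm_eq_abs]
    unfold Function.uncurry
    fun_prop)]
  calc ∫⁻ v in Set.Icc p q, ∫⁻ x in Set.Icc p q,
        ENNReal.ofReal (Real.exp (-c * |x - v|)) * ENNReal.ofReal (|v - y| ^ a)
      ≤ ∫⁻ v in Set.Icc p q, (∫⁻ x : ℝ, ENNReal.ofReal (Real.exp (-c * |x|))) *
          ENNReal.ofReal (|v - y| ^ a) := by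
        refine lintegral_mono fun v => ?_
        rw [lintegral_mul_const' _ _ ENNReal.ofReal_ne_top]
        refine mul_le_mul_left ?_ _
        refine (setLIntegral_le_lintegral _ _).trans_eq ?_
        exact lintegral_sub_right_eq_self (μ := volume)
          (fun x : ℝ => ENNReal.ofReal (Real.exp (-c * |x|))) v
    _ = (∫⁻ x : ℝ, ENNReal.ofReal (Real.exp (-c * |x|))) *
          ∫⁻ v in Set.Icc p q, ENNReal.ofReal (|v - y| ^ a) := by
        rw [lintegral_const_mul]
        simp only [← Real.norm_eq_abs]
        fun_prop
    _ ≤ _ := by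
        refine mul_le_mul_right ?_ _
        rw [← lintegral_indicator measurableSet_Icc, ← lintegral_indicator measurableSet_Icc,
          ← lintegral_sub_right_eq_self (μ := volume) (Set.indicator (Set.Icc (-(q - p)) _) _) y]
        refine lintegral_mono fun v => ?_
        by_cases hv : v ∈ Set.Icc p q
        · rw [Set.indicator_of_mem hv, Set.indicator_of_mem]
          constructor <;> linarith [hv.1, hv.2, hy.1, hy.2]
        · rw [Set.indicator_of_notMem hv]
          exact zero_le

theorem lintegral_cyclic_exp_rpow_eq (c a p q : ℝ) (N : ℕ) [NeZero N] :
    ∫⁻ uv : (Fin N → ℝ) × (Fin N → ℝ) in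
        (Set.univ.pi fun _ => Set.Icc p q) ×ˢ (Set.univ.pi fun _ => Set.Icc p q),
        ENNReal.ofReal (∏ i : Fin N,
          Real.exp (-c * |uv.1 i - uv.2 i|) * |uv.2 i - uv.1 (i + 1)| ^ a) =
      ∫⁻ u, ∏ i, expRpowKernel c a p q (u i) (u (i + 1))
        ∂(Measure.pi fun _ : Fin N => volume.restrict (Set.Icc p q)) := by
  have hr : (volume : Measure (Fin N → ℝ)).restrict (Set.univ.pi fun _ => Set.Icc p q) =
      Measure.pi fun _ : Fin N => volume.restrict (Set.Icc p q) :=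
    Measure.restrict_pi_pi _ _
  rw [Measure.volume_eq_prod, ← Measure.prod_restrict, hr, lintegral_prod]
  · refine lintegral_congr fun u => ?_
    unfold expRpowKernel
    rw [← lintegral_fin_nat_prod_eq_prod _ (fun i v => ENNReal.ofReal
      (Real.exp (-c * |u i - v|)) * ENNReal.ofReal (|v - u (i + 1)| ^ a))]
    · refine lintegral_congr fun v => ?_
      rw [ENNReal.ofReal_prod_of_nonneg fun i _ => by positivity]
      exact Finset.prod_congr rfl fun i _ => ENNReal.ofReal_mul (by positivity)
    · intro i
      simp only [← Real.norm_eq_abs]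
      fun_prop
  · simp only [← Real.norm_eq_abs]
    fun_prop

theorem stmt14 (H c : ℝ) (hH : H ∈ Set.Ioo (1 / 2 : ℝ) 1) (hc : 0 < c)
    (N : ℕ) [NeZero N] (hN : 2 ≤ N) (s t : ℝ) (hst : s < t) :
    ∃ C : ℝ, ∀ ε ∈ Set.Ioc (0 : ℝ) 1,
      ε ^ N *
          ∫ uv : (Fin N → ℝ) × (Fin N → ℝ) in
            (Set.univ.pi fun _ => Set.Icc (s / ε) (t / ε)) ×ˢ
              (Set.univ.pi fun _ => Set.Icc (s / ε) (t / ε)),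
            ∏ i : Fin N,
              Real.exp (-c * |uv.1 i - uv.2 i|) * |uv.2 i - uv.1 (i + 1)| ^ (2 * H - 2) ≤
        C * ε ^ (2 - 2 * H) := by
  obtain ⟨n, rfl⟩ := Nat.exists_eq_add_of_le' hN
  obtain ⟨hH1, hH2⟩ := hH
  set a : ℝ := 2 * H - 2 with ha
  have ha1 : -1 < a := by linarith
  have ha0 : a ≤ 0 := by linarith
  have hB := lintegral_exp_neg_mul_abs_lt_top hc
  set B := ∫⁻ x : ℝ, ENNReal.ofReal (Real.exp (-c * |x|))
  set M := (∫⁻ v in Set.Icc (-1 : ℝ) 1, ENNReal.ofReal (|v| ^ a)) + B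
  have hMtop : M < ∞ := ENNReal.add_lt_top.2
    ⟨(lintegral_abs_rpow_Icc_le ha1 zero_le_one).trans_lt ENNReal.ofReal_lt_top, hB⟩
  set D : ℝ := 2 / (a + 1)
  have hD : 0 < D := div_pos two_pos (by linarith)
  have hT : 0 < t - s := sub_pos.2 hst
  refine ⟨B.toReal * D * M.toReal ^ (n + 1) * (t - s) ^ (a + 1) * (t - s) ^ (n + 1),
    fun ε ⟨hε, _⟩ => ?_⟩
  have hL : 0 < t / ε - s / ε := by rw [← sub_div]; positivity
  set L := t / ε - s / ε with hLdef
  have hLeq : L = (t - s) / ε := by rw [hLdef, sub_div]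
  have hbound : ∫ uv : (Fin (n + 2) → ℝ) × (Fin (n + 2) → ℝ) in
      (Set.univ.pi fun _ => Set.Icc (s / ε) (t / ε)) ×ˢ
        (Set.univ.pi fun _ => Set.Icc (s / ε) (t / ε)),
      ∏ i : Fin (n + 2), Real.exp (-c * |uv.1 i - uv.2 i|) * |uv.2 i - uv.1 (i + 1)| ^ a ≤
      B.toReal * (D * L ^ (a + 1)) * M.toReal ^ (n + 1) * L ^ (n + 1) := by
    rw [integral_eq_lintegral_of_nonneg_ae, lintegral_cyclic_exp_rpow_eq]
    · have h := lintegral_prod_cyclic_le (volume.restrict (Set.Icc (s / ε) (t / ε))) n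
        (expRpowKernel c a (s / ε) (t / ε)) (measurable_expRpowKernel _ _ _ _)
        (B * ENNReal.ofReal (D * L ^ (a + 1))) M
        (fun x y => expRpowKernel_le hc ha0 _ _ x y) (by
          filter_upwards [ae_restrict_mem measurableSet_Icc] with y hy
          refine (setLIntegral_expRpowKernel_le hy).trans ?_
          exact mul_le_mul_right (lintegral_abs_rpow_Icc_le ha1 hL.le) _)
      rw [Measure.restrict_apply_univ, Real.volume_Icc] at h
      refine (ENNReal.toReal_mono ?_ h).trans_eq ?_
      · have hBtop := hB.ne
        have hMtop' := hMtop.ne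
        finiteness
      · simp only [ENNReal.toReal_mul, ENNReal.toReal_pow]
        rw [ENNReal.toReal_ofReal (by positivity), ENNReal.toReal_ofReal hL.le]
    · exact Filter.Eventually.of_forall fun uv => Finset.prod_nonneg fun i _ => by positivity
    · refine Measurable.aestronglyMeasurable ?_
      simp only [← Real.norm_eq_abs]
      fun_prop
  refine (mul_le_mul_of_nonneg_left hbound (by positivity)).trans_eq ?_
  have h1 : ε ^ (n + 2) = ε ^ (2 - 2 * H) * ε ^ (a + 1) * ε ^ (n + 1) := by
    rw [← Real.rpow_add hε, pow_succ' ε (n + 1)]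
    congr 1
    rw [ha, show 2 - 2 * H + (2 * H - 2 + 1) = 1 by ring, Real.rpow_one]
  rw [h1, hLeq, Real.div_rpow hT.le hε.le, div_pow]
  have h2 : ε ^ (a + 1) ≠ 0 := (Real.rpow_pos_of_pos hε _).ne'
  field_simp
end
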